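/- The unique Lipschitzian solution φ of φ(x) = ∫_Ω g(ω) φ(f(x,ω)) μ(dω) + F(x) satisfies, for every x ∈ X, ‖φ(x)‖ ≤ |1 − γ|^{−1} ( L(1 − λ)^{−1} ∫_Ω |g(ω)| ρ(f(x,ω), x) μ(dω) + ‖F(x)‖ ). -/

import Mathlib

open MeasureTheory

/-- Pointwise bound (8) for the unique Lipschitzian solution. -/
theorem stmt_9 {Ω : Type*} [MeasurableSpace Ω] (μ : MeasureTheory.Measure Ω)
    {X : Type*} [MetricSpace X] [TopologicalSpace.SeparableSpace X]
    [MeasurableSpace X] [BorelSpace X]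
    {𝕂 : Type*} [RCLike 𝕂]
    {Y : Type*} [NormedAddCommGroup Y] [NormedSpace 𝕂 Y] [NormedSpace ℝ Y] [CompleteSpace Y]
    (f : X → Ω → X) (g : Ω → 𝕂) (F : X → Y) (L : NNReal)
    (hf : ∀ x, Measurable (f x))
    (hg : Integrable g μ)
    (hint : ∀ x, Integrable (fun ω => ‖g ω‖ * dist (f x ω) x) μ)
    (lam : ℝ) (hlam : lam ∈ Set.Ico (0 : ℝ) 1)
    (hcontr : ∀ x z : X, (∫ ω, ‖g ω‖ * dist (f x ω) (f z ω) ∂μ) ≤ lam * dist x z)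
    (hF : LipschitzWith L F)
    (γ : 𝕂) (hγ : γ = ∫ ω, g ω ∂μ) (hγ1 : γ ≠ 1)
    (φ : X → Y)
    (hφ : ∃ K : NNReal, LipschitzWith K φ)
    (hsol : ∀ x, Integrable (fun ω => g ω • φ (f x ω)) μ ∧
      φ x = (∫ ω, g ω • φ (f x ω) ∂μ) + F x) :
    ∀ x : X, ‖φ x‖ ≤ ‖1 - γ‖⁻¹ *
      ((L : ℝ) * (1 - lam)⁻¹ * (∫ ω, ‖g ω‖ * dist (f x ω) x ∂μ) + ‖F x‖) := by 
  haveI : SecondCountableTopology X := UniformSpace.secondCountable_of_separable X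
  obtain ⟨hl0, hl1⟩ := hlam
  have h1l : 0 < 1 - lam := by linarith
  have hI : ∀ x z, Integrable (fun ω => ‖g ω‖ * dist (f x ω) (f z ω)) μ := by
    intro x z
    have hb : Integrable (fun ω => ‖g ω‖ * dist (f x ω) x + ‖g ω‖ * dist x z
        + ‖g ω‖ * dist (f z ω) z) μ :=
      ((hint x).add (hg.norm.mul_const _)).add (hint z)
    refine hb.mono' (hg.norm.aestronglyMeasurable.mul
      ((hf x).dist (hf z)).aestronglyMeasurable) (Filter.Eventually.of_forall fun ω => ?_)
    rw [Real.norm_of_nonneg (by positivity), ← mul_add, ← mul_add]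
    refine mul_le_mul_of_nonneg_left ?_ (norm_nonneg _)
    have := dist_triangle4 (f x ω) x z (f z ω)
    rwa [dist_comm z] at this
  have step : ∀ C : ℝ, (∀ x z, ‖φ x - φ z‖ ≤ C * dist x z) → 0 ≤ C →
      ∀ x z, ‖φ x - φ z‖ ≤ (lam * C + L) * dist x z := by
    intro C hC hC0 x z
    have e : φ x - φ z = (∫ ω, (g ω • φ (f x ω) - g ω • φ (f z ω)) ∂μ) + (F x - F z) := by
      rw [integral_sub (hsol x).1 (hsol z).1]
      nth_rewrite 1 [(hsol x).2, (hsol z).2]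
      abel
    have h1 : ‖∫ ω, (g ω • φ (f x ω) - g ω • φ (f z ω)) ∂μ‖
        ≤ ∫ ω, C * (‖g ω‖ * dist (f x ω) (f z ω)) ∂μ := by
      refine norm_integral_le_of_norm_le ((hI x z).const_mul C)
        (Filter.Eventually.of_forall fun ω => ?_)
      rw [← smul_sub, norm_smul]
      have := mul_le_mul_of_nonneg_left (hC (f x ω) (f z ω)) (norm_nonneg (g ω))
      linarith
    rw [integral_const_mul] at h1
    have h2 := mul_le_mul_of_nonneg_left (hcontr x z) hC0
    have h3 := hF.dist_le_mul x z
    rw [dist_eq_norm (F x)] at h3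
    have h4 := norm_add_le (∫ ω, (g ω • φ (f x ω) - g ω • φ (f z ω)) ∂μ) (F x - F z)
    rw [← e] at h4
    linarith
  obtain ⟨K, hK⟩ := hφ
  have hn : ∀ n : ℕ, ∀ x z, ‖φ x - φ z‖ ≤ (lam ^ n * K + L * (1 - lam)⁻¹) * dist x z := by
    intro n
    induction n with
    | zero =>
      intro x z
      have h := hK.dist_le_mul x z
      rw [dist_eq_norm (φ x)] at h
      have : 0 ≤ (L : ℝ) * (1 - lam)⁻¹ * dist x z := by positivity
      linarith
    | succ n ih =>
      intro x z
      have h := step _ ih (by positivity) x z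
      convert h using 2
      field_simp
      ring
  have hLip : ∀ x z, ‖φ x - φ z‖ ≤ (L * (1 - lam)⁻¹) * dist x z := by
    intro x z
    have ht : Filter.Tendsto (fun n : ℕ => (lam ^ n * K + L * (1 - lam)⁻¹) * dist x z)
        Filter.atTop (nhds ((0 * K + L * (1 - lam)⁻¹) * dist x z)) :=
      (((tendsto_pow_atTop_nhds_zero_of_lt_one hl0 hl1).mul_const _).add_const _).mul_const _
    have := ge_of_tendsto' ht (fun n => hn n x z)
    simpa using this
  intro x
  have e : (1 - γ) • φ x = (∫ ω, (g ω • φ (f x ω) - g ω • φ x) ∂μ) + F x := by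
    rw [integral_sub (hsol x).1 (hg.smul_const _), integral_smul_const, ← hγ, sub_smul, one_smul]
    nth_rewrite 1 [(hsol x).2]
    abel
  have h1 : ‖∫ ω, (g ω • φ (f x ω) - g ω • φ x) ∂μ‖
      ≤ ∫ ω, (L * (1 - lam)⁻¹) * (‖g ω‖ * dist (f x ω) x) ∂μ := by
    refine norm_integral_le_of_norm_le ((hint x).const_mul _)
      (Filter.Eventually.of_forall fun ω => ?_)
    rw [← smul_sub, norm_smul]
    have := mul_le_mul_of_nonneg_left (hLip (f x ω) x) (norm_nonneg (g ω))
    linarith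
  rw [integral_const_mul] at h1
  have h4 := norm_add_le (∫ ω, (g ω • φ (f x ω) - g ω • φ x) ∂μ) (F x)
  rw [← e, norm_smul] at h4
  have hp : 0 < ‖1 - γ‖ := norm_pos_iff.mpr (sub_ne_zero.mpr hγ1.symm)
  rw [inv_mul_eq_div, le_div_iff₀ hp]
  linarith
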